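/- Let (f, A, C) be an a-orbit of the mini-boson-star system with parameters a > 0, α > 1, defined on an interval containing [x₁, x₂), and suppose A(x) C(x)² ≤ α² on this interval, f'(x₁) = 0, f(x₁)² < B for some B > 0, and f(x)·f'(x) < 0 for all x in (x₁, x₂). Then A(x)·f'(x)² ≤ max(B, α²/3) for all x in (x₁, x₂). In particular, if an orbit crashes at x̄ while in the second or fourth quadrant of the (f, f')-plane after such a point x₁, then lim_{x→x̄⁻} A(x)·f'(x) = 0. -/

import Mathlib

open Real Set Filter Topology MeasureTheory

noncomputable section

/-- The mini-boson-star ODE system for `f, A, C` on a set `s ⊆ (0, ∞)`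
(prime denotes `d/dx`):
`(x² f'/C)' = (x²/(A C))·(1 − A C²)·f`,
`A' = (1 − A)/x − x·(A f'² + A C² f² + f²)`,
`C' = (C/(x A))·(A − 1 + x² f²)`, with `A > 0` and `C > 0`. -/
def MiniBosonSystem (f A C : ℝ → ℝ) (s : Set ℝ) : Prop :=
  ∀ x ∈ s, 0 < x ∧ 0 < A x ∧ 0 < C x ∧
    DifferentiableAt ℝ f x ∧ DifferentiableAt ℝ (deriv f) x ∧
    DifferentiableAt ℝ A x ∧ DifferentiableAt ℝ C x ∧
    deriv (fun y => y ^ 2 * deriv f y / C y) x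
      = x ^ 2 / (A x * C x) * (1 - A x * C x ^ 2) * f x ∧
    deriv A x = (1 - A x) / x
      - x * (A x * deriv f x ^ 2 + A x * C x ^ 2 * f x ^ 2 + f x ^ 2) ∧
    deriv C x = C x / (x * A x) * (A x - 1 + x ^ 2 * f x ^ 2)

/-- A domain of the form `[0, x̄)` with `0 < x̄ ≤ ∞`. -/
def IsOrbitDomain (s : Set ℝ) : Prop :=
  s = Set.Ici (0 : ℝ) ∨ ∃ xbar > (0 : ℝ), s = Set.Ico 0 xbar

/-- An `a`-orbit of the mini-boson-star system with parameters `a, α` on the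
domain `s = [0, x̄)`: a solution of the system on `s \ {0}`, continuous up to
`x = 0` with `f` differentiable at `0`, satisfying `f 0 = a`, `f' 0 = 0`,
`A 0 = 1`, `C 0 = α`. -/
def IsAOrbit (f A C : ℝ → ℝ) (a α : ℝ) (s : Set ℝ) : Prop :=
  IsOrbitDomain s ∧
  MiniBosonSystem f A C (s \ {0}) ∧
  ContinuousWithinAt f s 0 ∧ ContinuousWithinAt A s 0 ∧ ContinuousWithinAt C s 0 ∧
  HasDerivWithinAt f 0 s 0 ∧
  f 0 = a ∧ A 0 = 1 ∧ C 0 = α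

/-- The mass function `M(x) = x (1 − A x)/2`. -/
def massFn (A : ℝ → ℝ) (x : ℝ) : ℝ := x * (1 - A x) / 2

/-- `θ` is the rotation function of the orbit with scalar field `f`:
`θ` is continuous on the domain, `θ 0 = 0`, and for every `x` in the domain
there is `ρ x > 0` with `f x = ρ x · cos (θ x)` and `f' x = −ρ x · sin (θ x)`. -/
def IsRotation (f θ : ℝ → ℝ) (s : Set ℝ) : Prop :=
  ContinuousOn θ s ∧ θ 0 = 0 ∧
  ∀ x ∈ s, ∃ ρ > (0 : ℝ), f x = ρ * Real.cos (θ x) ∧ deriv f x = -(ρ * Real.sin (θ x))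

/-- The right-hand side of the equation for `(A f'²)'` is negative where `A f'²` is at least
`α²/3` and exceeds `f²`. -/
lemma kinetic_rate_neg {x A F p v α : ℝ} (hx : 0 < x) (hA : 0 < A) (hFp : F * p < 0)
    (hF : F ^ 2 < A * p ^ 2) (hα : α ^ 2 / 3 ≤ A * p ^ 2) (hv₀ : 0 ≤ v)
    (hv : v ≤ α ^ 2) :
    p ^ 2 * (-(1 + 3 * A) / x + x * F ^ 2 * (1 - v) - x * (A * p ^ 2)) + 2 * (F * p) * (1 - v)
      < 0 := by
  have hp : 0 < p ^ 2 := by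
    have : p ≠ 0 := by rintro rfl; simp at hFp
    positivity
  suffices h : p ^ 2 * (-(1 + 3 * A) + x ^ 2 * F ^ 2 * (1 - v) - x ^ 2 * (A * p ^ 2))
      + 2 * (F * p) * (1 - v) * x < 0 by
    have e : p ^ 2 * (-(1 + 3 * A) / x + x * F ^ 2 * (1 - v) - x * (A * p ^ 2))
        + 2 * (F * p) * (1 - v)
        = (p ^ 2 * (-(1 + 3 * A) + x ^ 2 * F ^ 2 * (1 - v) - x ^ 2 * (A * p ^ 2))
          + 2 * (F * p) * (1 - v) * x) / x := by
      field_simp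
    rw [e]
    exact div_neg_of_neg_of_pos h hx
  have hG : 0 < x ^ 2 * p ^ 2 * (A * p ^ 2) := by positivity
  have hAp : 0 < A * p ^ 2 := by positivity
  have hxp : 0 < x ^ 2 * p ^ 2 := by positivity
  rcases lt_or_ge 1 v with h | h
  · have hsq := mul_nonneg (sub_pos.2 h).le (sq_nonneg (1 + x * (F * p)))
    nlinarith
  · have h0 : 0 ≤ x ^ 2 * p ^ 2 * (A * p ^ 2 - F ^ 2) := mul_nonneg hxp.le (sub_pos.2 hF).le
    have h1 : 0 ≤ -(F * p) * (1 - v) * x :=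
      mul_nonneg (mul_nonneg (neg_pos.2 hFp).le (sub_nonneg.2 h)) hx.le
    have h2 : 0 ≤ x ^ 2 * p ^ 2 * F ^ 2 * v := by positivity
    nlinarith

/-- The derivative of `A f'²` along a solution of the mini-boson-star system. -/
lemma MiniBosonSystem.hasDerivAt_kinetic {f A C : ℝ → ℝ} {s : Set ℝ}
    (h : MiniBosonSystem f A C s) {x : ℝ} (hxs : x ∈ s) :
    HasDerivAt (fun y => A y * deriv f y ^ 2)
      (deriv f x ^ 2 * (-(1 + 3 * A x) / x + x * f x ^ 2 * (1 - A x * C x ^ 2)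
        - x * (A x * deriv f x ^ 2)) + 2 * (f x * deriv f x) * (1 - A x * C x ^ 2)) x := by
  obtain ⟨hx, hA, hC, -, hf', hdA, hdC, e₁, e₂, e₃⟩ := h x hxs
  have hflux := (((hasDerivAt_id x).pow 2).mul hf'.hasDerivAt).div hdC.hasDerivAt hC.ne'
  have e₄ := hflux.deriv.symm.trans e₁
  have key := hdA.hasDerivAt.mul (hf'.hasDerivAt.pow 2)
  refine key.congr_deriv ?_
  simp only [Pi.mul_apply, Pi.pow_apply, id] at e₄ ⊢
  rw [e₃] at e₄
  rw [e₂]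
  have e₅ : A x * deriv (deriv f) x = (1 - A x * C x ^ 2) * f x - 2 * A x / x * deriv f x
      + (A x - 1 + x ^ 2 * f x ^ 2) / x * deriv f x := by
    field_simp at e₄ ⊢
    refine mul_left_cancel₀ hx.ne' ?_
    push_cast at e₄
    linear_combination e₄
  push_cast
  have e₆ : A x * (2 * deriv f x ^ (2 - 1) * deriv (deriv f) x)
      = 2 * deriv f x * (A x * deriv (deriv f) x) := by
    norm_num; ring
  rw [e₆, e₅]
  field_simp
  ring

/-- Just to the right of a critical point of `f`, there are points with `A f'²` arbitrarily
small, even if `f'` is not assumed to be continuous there. -/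
lemma exists_kinetic_lt {f A : ℝ → ℝ} {x₁ b M : ℝ} (hb : x₁ < b) (hM : 0 < M)
    (hf : HasDerivWithinAt f 0 (Ici x₁) x₁) (hd : ∀ x ∈ Ioo x₁ b, DifferentiableAt ℝ f x)
    (hA : ContinuousWithinAt A (Ici x₁) x₁) :
    ∃ ξ ∈ Ioo x₁ b, A ξ * deriv f ξ ^ 2 < M := by
  have hK : 0 < |A x₁| + 1 := by positivity
  have hA' : ∀ᶠ y in 𝓝[>] x₁, A y < |A x₁| + 1 :=
    (hA.mono Ioi_subset_Ici_self).eventually_lt_const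
      (lt_of_le_of_lt (le_abs_self _) (lt_add_one _))
  have hslope : Tendsto (slope f x₁) (𝓝[>] x₁) (𝓝 0) := by
    have := hasDerivWithinAt_iff_tendsto_slope.1 hf
    rwa [Ici_sdiff_left] at this
  have hsq : ∀ᶠ y in 𝓝[>] x₁, slope f x₁ y ^ 2 < M / (|A x₁| + 1) := by
    refine (hslope.pow 2).eventually_lt_const ?_
    simpa using div_pos hM hK
  obtain ⟨u, hu, hus⟩ := mem_nhdsGT_iff_exists_Ioo_subset.1 (hA'.and hsq)
  obtain ⟨y, hy₁, hy₂⟩ := exists_between (lt_min hu hb)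
  obtain ⟨hyu, hyb⟩ := lt_min_iff.1 hy₂
  have hcont : ContinuousOn f (Icc x₁ y) := by
    intro z hz
    rcases hz.1.eq_or_lt with rfl | h
    · exact hf.continuousWithinAt.mono Icc_subset_Ici_self
    · exact (hd z ⟨h, hz.2.trans_lt hyb⟩).continuousAt.continuousWithinAt
  obtain ⟨ξ, hξ, e⟩ := exists_deriv_eq_slope f hy₁ hcont
    fun z hz => (hd z ⟨hz.1, hz.2.trans hyb⟩).differentiableWithinAt
  have hξb : ξ ∈ Ioo x₁ b := ⟨hξ.1, hξ.2.trans hyb⟩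
  refine ⟨ξ, hξb, ?_⟩
  have h₁ := (hus ⟨hξ.1, hξ.2.trans hyu⟩).1
  have h₂ := (hus ⟨hy₁, hyu⟩).2
  rw [slope_def_field, ← e] at h₂
  calc A ξ * deriv f ξ ^ 2 ≤ (|A x₁| + 1) * deriv f ξ ^ 2 := by
        gcongr
    _ < M := by rwa [lt_div_iff₀' hK] at h₂

/-- Along an `a`-orbit with `A C² ≤ α²`, if `f' x₁ = 0`, `f x₁ ² < B` and
`f · f' < 0` on `(x₁, x₂)`, then `A f'² ≤ max B (α²/3)` on `(x₁, x₂)`.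
In particular, if the orbit crashes at `x₂` while staying in the second or
fourth quadrant after `x₁`, then `A f' → 0` at the crash. -/
theorem A_fprime_sq_bounded (f A C : ℝ → ℝ) (a α : ℝ) (s : Set ℝ)
    (x₁ x₂ B : ℝ) (ha : 0 < a) (hα : 1 < α)
    (horbit : IsAOrbit f A C a α s)
    (hsub : Set.Ico x₁ x₂ ⊆ s) (hx : x₁ < x₂)
    (hAC : ∀ x ∈ s, A x * C x ^ 2 ≤ α ^ 2)
    (hB : 0 < B) (hf₁ : deriv f x₁ = 0) (hfB : f x₁ ^ 2 < B)
    (hQ : ∀ x ∈ Set.Ioo x₁ x₂, f x * deriv f x < 0) :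
    (∀ x ∈ Set.Ioo x₁ x₂, A x * deriv f x ^ 2 ≤ max B (α ^ 2 / 3)) ∧
    (s = Set.Ico 0 x₂ →
      Filter.Tendsto A (nhdsWithin x₂ (Set.Iio x₂)) (nhds 0) →
      Filter.Tendsto (fun x => A x * deriv f x)
        (nhdsWithin x₂ (Set.Iio x₂)) (nhds 0)) := by
  obtain ⟨hdom, hsys, hf0, hA0, -, hdf0, -, -, -⟩ := horbit
  have hs0 : s ⊆ Ici 0 := by
    rcases hdom with rfl | ⟨b, -, rfl⟩
    · exact Subset.rfl
    · exact fun z hz => hz.1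
  have hx₁ : x₁ ∈ s := hsub ⟨le_rfl, hx⟩
  have hx₁0 : 0 ≤ x₁ := hs0 hx₁
  have hmem : ∀ x ∈ Ioo x₁ x₂, x ∈ s \ {0} := fun x h =>
    ⟨hsub ⟨h.1.le, h.2⟩, (hx₁0.trans_lt h.1).ne'⟩
  have hnhds : Ico x₁ x₂ ∈ 𝓝[≥] x₁ := Ico_mem_nhdsGE hx
  have hstart : HasDerivWithinAt f 0 (Ici x₁) x₁ ∧ ContinuousWithinAt A (Ici x₁) x₁ := by
    rcases hx₁0.eq_or_lt with rfl | h
    · exact ⟨(hdf0.mono hsub).mono_of_mem_nhdsWithin hnhds,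
        (hA0.mono hsub).mono_of_mem_nhdsWithin hnhds⟩
    · obtain ⟨-, -, -, hd, -, hdA, -⟩ := hsys x₁ ⟨hx₁, h.ne'⟩
      exact ⟨hf₁ ▸ hd.hasDerivAt.hasDerivWithinAt, hdA.continuousAt.continuousWithinAt⟩
  have hd : ∀ x ∈ Ioo x₁ x₂, DifferentiableAt ℝ f x := fun x h =>
    (hsys x (hmem x h)).2.2.2.1
  have hApos : ∀ x ∈ Ioo x₁ x₂, 0 < A x := fun x h => (hsys x (hmem x h)).2.1
  have hfsq : ∀ x ∈ Ioo x₁ x₂, f x ^ 2 < B := by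
    have hanti : AntitoneOn (fun y => f y ^ 2) (Ico x₁ x₂) := by
      refine antitoneOn_of_deriv_nonpos (convex_Ico _ _) ?_ ?_ ?_
      · intro z hz
        rcases hz.1.eq_or_lt with rfl | h
        · exact (hstart.1.continuousWithinAt.mono Ico_subset_Ici_self).pow 2
        · exact ((hd z ⟨h, hz.2⟩).continuousAt.pow 2).continuousWithinAt
      · rw [interior_Ico]
        exact fun z hz => ((hd z hz).pow 2).differentiableWithinAt
      · rw [interior_Ico]
        intro z hz
        have e : deriv (fun y => f y ^ 2) z = 2 * (f z * deriv f z) := by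
          refine ((hd z hz).hasDerivAt.pow 2).deriv.trans ?_
          norm_num; ring
        rw [e]
        linarith [hQ z hz]
    exact fun x h => (hanti ⟨le_rfl, hx⟩ ⟨h.1.le, h.2⟩ h.1.le).trans_lt hfB
  have hbound : ∀ x ∈ Ioo x₁ x₂, A x * deriv f x ^ 2 ≤ max B (α ^ 2 / 3) := by
    intro x h
    obtain ⟨ξ, hξ, hlt⟩ := exists_kinetic_lt (M := max B (α ^ 2 / 3)) h.1
      (lt_max_of_lt_left hB) hstart.1 (fun z hz => hd z ⟨hz.1, hz.2.trans h.2⟩) hstart.2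
    have hin : ∀ z ∈ Icc ξ x, z ∈ Ioo x₁ x₂ := fun z hz =>
      ⟨hξ.1.trans_le hz.1, hz.2.trans_lt h.2⟩
    refine image_le_of_deriv_right_lt_deriv_boundary
      (f := fun y => A y * deriv f y ^ 2) (B := fun _ => max B (α ^ 2 / 3)) (B' := fun _ => 0)
      (fun z hz => (hsys.hasDerivAt_kinetic
        (hmem z (hin z hz))).continuousAt.continuousWithinAt)
      (fun z hz => (hsys.hasDerivAt_kinetic
        (hmem z (hin z (Ico_subset_Icc_self hz)))).hasDerivWithinAt)
      hlt.le (fun z => hasDerivAt_const z _) ?_ ⟨hξ.2.le, le_rfl⟩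
    intro z hz e
    have hz' := hin z (Ico_subset_Icc_self hz)
    have e' : A z * deriv f z ^ 2 = max B (α ^ 2 / 3) := e
    have hz0 := (hsys z (hmem z hz')).1
    refine kinetic_rate_neg hz0 (hApos z hz') (hQ z hz') ?_ ?_
      (mul_nonneg (hApos z hz').le (sq_nonneg _)) (hAC z (hmem z hz').1)
    · rw [e']
      exact (hfsq z hz').trans_le (le_max_left _ _)
    · rw [e']
      exact le_max_right _ _
  refine ⟨hbound, fun _ hAlim => ?_⟩
  have hsqlim : Tendsto (fun x => (A x * deriv f x) ^ 2) (𝓝[<] x₂) (𝓝 0) := by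
    have hup : Tendsto (fun x => A x * max B (α ^ 2 / 3)) (𝓝[<] x₂) (𝓝 0) := by
      simpa using hAlim.mul_const (max B (α ^ 2 / 3))
    refine squeeze_zero' (Eventually.of_forall fun x => sq_nonneg _) ?_ hup
    filter_upwards [Ioo_mem_nhdsLT hx] with x h
    rw [mul_pow, sq (A x), mul_assoc]
    exact mul_le_mul_of_nonneg_left (hbound x h) (hApos x h).le
  refine (tendsto_zero_iff_abs_tendsto_zero _).2 ?_
  simpa [Function.comp_def, Real.sqrt_sq_eq_abs] using hsqlim.sqrt
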